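/- arXiv:0707.1521 — 6 statements merged into one kernel-verified Lean document; each statement's English description precedes it below -/
import Mathlib

section
/- Let Ψ and Φ be unit vectors in H = ℂ^{d_A} ⊗ ℂ^{d_B} that are one-sided orthogonal on the B side. Then there exist natural numbers d₁, d₂ with d₁ ≤ d_A, d₂ ≤ d_A and d₁ + d₂ ≤ d_B, an orthonormal family (u_i)_{i=1}^{d₁} in ℂ^{d_A}, an orthonormal family (v_j)_{j=1}^{d₂} in ℂ^{d_A}, an orthonormal family (w_k)_{k=1}^{d₁+d₂} in ℂ^{d_B}, and strictly positive reals (p_i)_{i=1}^{d₁} and (q_j)_{j=1}^{d₂}, each summing to 1, such that Ψ = ∑_{i=1}^{d₁} √p_i · u_i ⊗ w_i and Φ = ∑_{j=1}^{d₂} √q_j · v_j ⊗ w_{d₁+j}. -/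
open scoped BigOperators

noncomputable section

namespace EoS

/-- Vectors of `ℂ^{dA} ⊗ ℂ^{dB}`, modeled as `EuclideanSpace ℂ (Fin dA × Fin dB)`. -/
abbrev TensorSpace (dA dB : ℕ) := EuclideanSpace ℂ (Fin dA × Fin dB)

variable {dA dB : ℕ}

/-- The rank-one operator `|ψ⟩⟨ψ| = ψ ψ†`, as a matrix. -/
def ketbra (ψ : TensorSpace dA dB) : Matrix (Fin dA × Fin dB) (Fin dA × Fin dB) ℂ :=
  fun p q => ψ p * (starRingEnd ℂ) (ψ q)

/-- Partial trace over the `B` system. -/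
def trB (ρ : Matrix (Fin dA × Fin dB) (Fin dA × Fin dB) ℂ) : Matrix (Fin dA) (Fin dA) ℂ :=
  fun a a' => ∑ b : Fin dB, ρ (a, b) (a', b)

/-- Partial trace over the `A` system. -/
def trA (ρ : Matrix (Fin dA × Fin dB) (Fin dA × Fin dB) ℂ) : Matrix (Fin dB) (Fin dB) ℂ :=
  fun b b' => ∑ a : Fin dA, ρ (a, b) (a, b')

open scoped Classical in
/-- Von Neumann entropy (base-2), via eigenvalues; junk value `0` on non-Hermitian input. -/
def vnEntropy {n : Type*} [Fintype n] [DecidableEq n] (ρ : Matrix n n ℂ) : ℝ :=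
  if h : ρ.IsHermitian then -∑ i, (h.eigenvalues i) * Real.logb 2 (h.eigenvalues i) else 0

/-- Entropy of entanglement of a (unit) vector. -/
def ent (ψ : TensorSpace dA dB) : ℝ := vnEntropy (trB (ketbra ψ))

/-- Entropy of entanglement of a nonzero, not necessarily normalized, vector. -/
def entN (ψ : TensorSpace dA dB) : ℝ := ent ((‖ψ‖ : ℝ)⁻¹ • ψ)

/-- Binary entropy (base 2). -/
def h2 (x : ℝ) : ℝ := -x * Real.logb 2 x - (1 - x) * Real.logb 2 (1 - x)

/-- Elementary tensor `u ⊗ w`. -/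
def tensor (u : EuclideanSpace ℂ (Fin dA)) (w : EuclideanSpace ℂ (Fin dB)) :
    TensorSpace dA dB := WithLp.toLp 2 fun p => u p.1 * w p.2

/-- One-sided orthogonality on the `B` side:
`Tr[Tr_A(|Ψ⟩⟨Ψ|) ⬝ Tr_A(|Φ⟩⟨Φ|)] = 0`. -/
def OneSidedOrthB (Ψ Φ : TensorSpace dA dB) : Prop :=
  Matrix.trace (trA (ketbra Ψ) * trA (ketbra Φ)) = 0


open scoped ComplexOrder in
/-- Schmidt decomposition, with the `B`-side vectors being combinations of the rows. -/
theorem schmidt_aux {dA dB : ℕ} (Ψ : TensorSpace dA dB) (hΨ : ‖Ψ‖ = 1) :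
    ∃ (d : ℕ) (u : Fin d → EuclideanSpace ℂ (Fin dA))
      (w : Fin d → EuclideanSpace ℂ (Fin dB)) (p : Fin d → ℝ) (c : Fin d → Fin dA → ℂ),
      Orthonormal ℂ u ∧ Orthonormal ℂ w ∧ (∀ i, 0 < p i) ∧ (∑ i, p i) = 1 ∧
      Ψ = ∑ i, (Real.sqrt (p i) : ℂ) • tensor (u i) (w i) ∧
      ∀ i b, w i b = ∑ a, c i a * Ψ (a, b) := by
  classical
  let M : Matrix (Fin dA) (Fin dB) ℂ := Matrix.of fun a b => Ψ (a, b)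
  have hps : (M * M.conjTranspose).PosSemidef := Matrix.posSemidef_self_mul_conjTranspose M
  have hA := hps.isHermitian
  let l := hA.eigenvalues
  have hl0 : ∀ i, 0 ≤ l i := hps.eigenvalues_nonneg
  let U : Matrix (Fin dA) (Fin dA) ℂ := hA.eigenvectorUnitary
  have hUU : U * star U = 1 := Unitary.coe_mul_star_self hA.eigenvectorUnitary
  let X : Matrix (Fin dA) (Fin dB) ℂ := star U * M
  have hM : M = U * X := by
    simp only [X]; rw [← Matrix.mul_assoc, hUU, Matrix.one_mul]
  have hX : X * X.conjTranspose = Matrix.diagonal (fun i => (l i : ℂ)) := by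
    have h := hA.conjStarAlgAut_star_eigenvectorUnitary
    rw [Unitary.conjStarAlgAut_star_apply] at h
    have h2 : X * X.conjTranspose = star U * (M * M.conjTranspose) * U := by
      simp only [X, Matrix.conjTranspose_mul, Matrix.star_eq_conjTranspose,
        Matrix.conjTranspose_conjTranspose, Matrix.mul_assoc]
    rw [h2]
    exact h
  have hXij : ∀ i j, ∑ b, X i b * (starRingEnd ℂ) (X j b) = if i = j then (l i : ℂ) else 0 := by
    intro i j
    have := congrFun (congrFun hX i) j
    simpa [Matrix.mul_apply, Matrix.diagonal_apply] using this
  have hX0 : ∀ i, ¬ 0 < l i → ∀ b, X i b = 0 := by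
    intro i hi b
    have h0 : l i = 0 := le_antisymm (not_lt.mp hi) (hl0 i)
    have h1 := hXij i i
    simp only [if_true, h0, Complex.ofReal_zero, Complex.mul_conj] at h1
    have h2 : ∑ b, Complex.normSq (X i b) = 0 := by exact_mod_cast h1
    rw [Finset.sum_eq_zero_iff_of_nonneg (fun b _ => Complex.normSq_nonneg _)] at h2
    exact Complex.normSq_eq_zero.mp (h2 b (Finset.mem_univ b))
  have hsum : ∑ i, l i = 1 := by
    have h1 := hA.trace_eq_sum_eigenvalues
    have h2 : (M * M.conjTranspose).trace = 1 := by
      have h3 : ∑ x, ‖Ψ x‖ ^ 2 = 1 := by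
        rw [← EuclideanSpace.norm_sq_eq, hΨ]; norm_num
      rw [Fintype.sum_prod_type] at h3
      simp only [Matrix.trace, Matrix.diag, Matrix.mul_apply, Matrix.conjTranspose_apply, M,
        Matrix.of_apply]
      have h4 : ∀ z : ℂ, z * star z = ((‖z‖ ^ 2 : ℝ) : ℂ) := by
        intro z
        rw [Complex.star_def, Complex.mul_conj, Complex.normSq_eq_norm_sq]
      simp only [h4]
      exact_mod_cast h3
    rw [h2] at h1
    have h5 : ((∑ i, l i : ℝ) : ℂ) = 1 := by
      rw [Complex.ofReal_sum]
      exact h1.symm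
    exact_mod_cast h5
  let S := {i : Fin dA // 0 < l i}
  let e : Fin (Fintype.card S) ≃ S := (Fintype.equivFin S).symm
  have hinj : Function.Injective (fun k => (e k : Fin dA)) :=
    Subtype.val_injective.comp e.injective
  have hpos : ∀ k, 0 < l (e k) := fun k => (e k).2
  have hsq : ∀ k, (Real.sqrt (l (e k)) : ℂ) ≠ 0 := fun k =>
    Complex.ofReal_ne_zero.mpr (Real.sqrt_pos.mpr (hpos k)).ne'
  have hss : ∀ k, (Real.sqrt (l (e k)) : ℂ) * (Real.sqrt (l (e k)) : ℂ) = (l (e k) : ℂ) := by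
    intro k
    rw [← Complex.ofReal_mul, Real.mul_self_sqrt (hpos k).le]
  have hre : ∀ {R : Type} [AddCommMonoid R] (f : Fin dA → R), (∀ i, ¬ 0 < l i → f i = 0) →
      ∑ k, f (e k) = ∑ i, f i := by
    intro R _ f hf
    rw [Equiv.sum_comp e (fun s : S => f s)]
    rw [← Finset.sum_subtype (Finset.univ.filter fun i => 0 < l i) (by simp) f]
    · rw [Finset.sum_filter_of_ne]
      · intro i _ hi
        by_contra h
        exact hi (hf i h)
  refine ⟨Fintype.card S, fun k => hA.eigenvectorBasis (e k),
    fun k => WithLp.toLp 2 fun b => (Real.sqrt (l (e k)) : ℂ)⁻¹ * X (e k) b,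
    fun k => l (e k), fun k a => (Real.sqrt (l (e k)) : ℂ)⁻¹ * star U (e k) a, ?_, ?_, hpos, ?_, ?_, ?_⟩
  · exact hA.eigenvectorBasis.orthonormal.comp _ hinj
  · rw [orthonormal_iff_ite]
    intro i j
    have h := hXij (e j) (e i)
    have h1 : inner ℂ (WithLp.toLp 2 fun b => (Real.sqrt (l (e i)) : ℂ)⁻¹ * X (e i) b : EuclideanSpace ℂ (Fin dB))
        (WithLp.toLp 2 fun b => (Real.sqrt (l (e j)) : ℂ)⁻¹ * X (e j) b) =
        (Real.sqrt (l (e i)) : ℂ)⁻¹ * (Real.sqrt (l (e j)) : ℂ)⁻¹ *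
          ∑ b, X (e j) b * (starRingEnd ℂ) (X (e i) b) := by
      simp only [PiLp.inner_apply, RCLike.inner_apply, map_mul, map_inv₀, Complex.conj_ofReal,
        Finset.mul_sum]
      exact Finset.sum_congr rfl fun b _ => by ring
    rw [h1, h]
    by_cases hij : i = j
    · subst hij
      simp only [if_true]
      rw [← hss]
      field_simp [hsq i]
    · rw [if_neg hij, if_neg (fun h => hij (hinj h.symm)), mul_zero]
  · rw [hre l (fun i hi => le_antisymm (not_lt.mp hi) (hl0 i)), hsum]
  · ext ⟨a, b⟩
    have h : Ψ (a, b) = ∑ i, U a i * X i b := by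
      have := congrFun (congrFun hM a) b
      simpa [Matrix.mul_apply, M] using this
    rw [h, ← hre (fun i => U a i * X i b) (fun i hi => by rw [hX0 i hi, mul_zero])]
    simp only [WithLp.ofLp_sum, Finset.sum_apply, WithLp.ofLp_smul, Pi.smul_apply, tensor,
      smul_eq_mul]
    refine Finset.sum_congr rfl fun k _ => ?_
    have : U a (e k) = hA.eigenvectorBasis (e k) a := rfl
    rw [this]
    field_simp [hsq k]
  · intro i b
    simp only [X, Matrix.mul_apply, Finset.mul_sum, M, Matrix.of_apply, mul_assoc]

theorem orth_rows {dA dB : ℕ} (Ψ Φ : TensorSpace dA dB) (horth : OneSidedOrthB Ψ Φ)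
    (a a' : Fin dA) : ∑ b, (starRingEnd ℂ) (Ψ (a, b)) * Φ (a', b) = 0 := by
  have key : Matrix.trace (trA (ketbra Ψ) * trA (ketbra Φ)) =
      ((∑ a, ∑ a', Complex.normSq (∑ b, (starRingEnd ℂ) (Ψ (a, b)) * Φ (a', b)) : ℝ) : ℂ) := by
    push_cast
    simp only [← Complex.mul_conj, map_sum, map_mul, Complex.conj_conj, Matrix.trace, Matrix.diag,
      Matrix.mul_apply, trA, ketbra, Finset.sum_mul_sum]
    calc _ = ∑ b, ∑ a, ∑ b', ∑ a', Ψ (a, b) * (starRingEnd ℂ) (Ψ (a, b')) *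
              (Φ (a', b') * (starRingEnd ℂ) (Φ (a', b))) :=
            Finset.sum_congr rfl fun b _ => Finset.sum_comm
      _ = ∑ a, ∑ b, ∑ b', ∑ a', Ψ (a, b) * (starRingEnd ℂ) (Ψ (a, b')) *
              (Φ (a', b') * (starRingEnd ℂ) (Φ (a', b))) := Finset.sum_comm
      _ = ∑ a, ∑ b, ∑ a', ∑ b', Ψ (a, b) * (starRingEnd ℂ) (Ψ (a, b')) *
              (Φ (a', b') * (starRingEnd ℂ) (Φ (a', b))) :=
            Finset.sum_congr rfl fun a _ => Finset.sum_congr rfl fun b _ => Finset.sum_comm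
      _ = ∑ a, ∑ a', ∑ b, ∑ b', Ψ (a, b) * (starRingEnd ℂ) (Ψ (a, b')) *
              (Φ (a', b') * (starRingEnd ℂ) (Φ (a', b))) :=
            Finset.sum_congr rfl fun a _ => Finset.sum_comm
      _ = _ := by
            refine Finset.sum_congr rfl fun a _ => Finset.sum_congr rfl fun a' _ => ?_
            rw [Finset.sum_comm]
            exact Finset.sum_congr rfl fun b _ => Finset.sum_congr rfl fun b' _ => by ring
  unfold OneSidedOrthB at horth
  rw [key] at horth
  have h0 := Complex.ofReal_eq_zero.mp horth
  rw [Finset.sum_eq_zero_iff_of_nonneg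
    (fun a _ => Finset.sum_nonneg fun a' _ => Complex.normSq_nonneg _)] at h0
  have h1 := h0 a (Finset.mem_univ a)
  rw [Finset.sum_eq_zero_iff_of_nonneg (fun a' _ => Complex.normSq_nonneg _)] at h1
  exact Complex.normSq_eq_zero.mp (h1 a' (Finset.mem_univ a'))

/-- Lemma 1 of the paper: one-sided orthogonal unit vectors admit a
simultaneous Schmidt-like decomposition with orthogonal `B`-side supports. -/
theorem one_sided_orthogonal_decomposition {dA dB : ℕ}
    (Ψ Φ : TensorSpace dA dB) (hΨ : ‖Ψ‖ = 1) (hΦ : ‖Φ‖ = 1)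
    (horth : OneSidedOrthB Ψ Φ) :
    ∃ (d₁ d₂ : ℕ), d₁ ≤ dA ∧ d₂ ≤ dA ∧ d₁ + d₂ ≤ dB ∧
      ∃ (u : Fin d₁ → EuclideanSpace ℂ (Fin dA))
        (v : Fin d₂ → EuclideanSpace ℂ (Fin dA))
        (w : Fin (d₁ + d₂) → EuclideanSpace ℂ (Fin dB))
        (p : Fin d₁ → ℝ) (q : Fin d₂ → ℝ),
        Orthonormal ℂ u ∧ Orthonormal ℂ v ∧ Orthonormal ℂ w ∧
        (∀ i, 0 < p i) ∧ (∀ j, 0 < q j) ∧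
        (∑ i, p i) = 1 ∧ (∑ j, q j) = 1 ∧
        Ψ = ∑ i, (Real.sqrt (p i) : ℂ) • tensor (u i) (w (Fin.castAdd d₂ i)) ∧
        Φ = ∑ j, (Real.sqrt (q j) : ℂ) • tensor (v j) (w (Fin.natAdd d₁ j)) := by
  obtain ⟨d₁, u, w₁, p, c, hu, hw₁, hp, hps, hΨe, hc⟩ := schmidt_aux Ψ hΨ
  obtain ⟨d₂, v, w₂, q, c', hv, hw₂, hq, hqs, hΦe, hc'⟩ := schmidt_aux Φ hΦ
  have hcross : ∀ i j, inner ℂ (w₁ i) (w₂ j) = 0 := by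
    intro i j
    simp only [PiLp.inner_apply, RCLike.inner_apply, hc, hc', map_sum, map_mul, Finset.sum_mul_sum]
    rw [Finset.sum_comm]
    refine Finset.sum_eq_zero fun a' _ => ?_
    rw [Finset.sum_comm]
    refine Finset.sum_eq_zero fun a _ => ?_
    have h := orth_rows Ψ Φ horth a a'
    calc _ = c' j a' * (starRingEnd ℂ) (c i a) *
          ∑ b, (starRingEnd ℂ) (Ψ (a, b)) * Φ (a', b) := by
            rw [Finset.mul_sum]
            exact Finset.sum_congr rfl fun b _ => by ring
      _ = 0 := by rw [h, mul_zero]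
  have hw : Orthonormal ℂ (Fin.append w₁ w₂) := by
    rw [orthonormal_iff_ite] at hw₁ hw₂ ⊢
    intro i j
    refine Fin.addCases (fun i => ?_) (fun i => ?_) i <;>
      refine Fin.addCases (fun j => ?_) (fun j => ?_) j
    · simp [hw₁]
    · rw [Fin.append_left, Fin.append_right, hcross, if_neg]
      intro h
      have := congrArg Fin.val h
      simp at this
      omega
    · rw [Fin.append_left, Fin.append_right, inner_eq_zero_symm.mp (hcross _ _), if_neg]
      intro h
      have := congrArg Fin.val h
      simp at this
      omega
    · simp [hw₂]
  have hcard : ∀ {m n : ℕ} (f : Fin m → EuclideanSpace ℂ (Fin n)), Orthonormal ℂ f → m ≤ n := by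
    intro m n f hf
    simpa using hf.linearIndependent.fintype_card_le_finrank
  refine ⟨d₁, d₂, hcard u hu, hcard v hv, hcard _ hw, u, v, Fin.append w₁ w₂, p, q, hu, hv, hw,
    hp, hq, hps, hqs, ?_, ?_⟩
  · simpa only [Fin.append_left] using hΨe
  · simpa only [Fin.append_right] using hΦe
end EoS
end
end

section
/- Let Ψ and Φ be unit vectors in H = ℂ^{d_A} ⊗ ℂ^{d_B} that are one-sided orthogonal on the B side, let α, β ∈ ℂ with |α|² + |β|² = 1, and set Γ = αΨ + βΦ, ρ^{AB} = |α|²|Ψ⟩⟨Ψ| + |β|²|Φ⟩⟨Φ|, ρ^A = Tr_B ρ^{AB}, ρ^B = Tr_A ρ^{AB}. Then Γ is a unit vector and E(Γ) = S(ρ^A) = |α|²E(Ψ) + |β|²E(Φ) + S(ρ^{AB}) − |S(ρ^A) − S(ρ^B)|. -/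
open scoped BigOperators

noncomputable section

namespace EoS

variable {dA dB : ℕ}

open Matrix Polynomial
open scoped ComplexOrder

/-- Entropy functional on the roots of a polynomial (natural logarithm). -/
def polyH (p : ℂ[X]) : ℝ := (p.roots.map fun z => Real.negMulLog z.re).sum

lemma polyH_mul {p q : ℂ[X]} (hp : p ≠ 0) (hq : q ≠ 0) :
    polyH (p * q) = polyH p + polyH q := by
  simp [polyH, roots_mul (mul_ne_zero hp hq)]

lemma polyH_X_pow (k : ℕ) : polyH ((X : ℂ[X]) ^ k) = 0 := by
  simp [polyH, Multiset.map_nsmul, Multiset.sum_nsmul]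

lemma polyH_prod {n : Type*} [Fintype n] (d : n → ℝ) :
    polyH (∏ i, (X - C (d i : ℂ))) = ∑ i, Real.negMulLog (d i) := by
  unfold polyH
  rw [Polynomial.roots_prod]
  · simp
  · simp [Finset.prod_ne_zero_iff, Polynomial.X_sub_C_ne_zero]

section gen
variable {m n : Type*} [Fintype n] [DecidableEq n] [Fintype m] [DecidableEq m]

lemma vn_eq_sum {ρ : Matrix n n ℂ} (h : ρ.IsHermitian) :
    vnEntropy ρ = (∑ i, Real.negMulLog (h.eigenvalues i)) / Real.log 2 := by
  rw [vnEntropy, dif_pos h, Finset.sum_div, ← Finset.sum_neg_distrib]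
  refine Finset.sum_congr rfl fun i _ => ?_
  simp only [Real.negMulLog, Real.logb]
  ring

lemma vn_eq {ρ : Matrix n n ℂ} (h : ρ.IsHermitian) :
    vnEntropy ρ = polyH ρ.charpoly / Real.log 2 := by
  rw [vn_eq_sum h, h.charpoly_eq]
  congr 1
  exact (polyH_prod _).symm

lemma vn_mul_comm (A : Matrix m n ℂ) : vnEntropy (A * Aᴴ) = vnEntropy (Aᴴ * A) := by
  rw [vn_eq (isHermitian_mul_conjTranspose_self A), vn_eq (isHermitian_conjTranspose_mul_self A)]
  congr 1
  have h := congrArg polyH (charpoly_mul_comm' A Aᴴ)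
  rw [polyH_mul (pow_ne_zero _ X_ne_zero) (charpoly_monic _).ne_zero,
    polyH_mul (pow_ne_zero _ X_ne_zero) (charpoly_monic _).ne_zero,
    polyH_X_pow, polyH_X_pow] at h
  simpa using h

lemma vn_transpose {ρ : Matrix n n ℂ} (h : ρ.IsHermitian) : vnEntropy ρᵀ = vnEntropy ρ := by
  rw [vn_eq h, vn_eq h.transpose, charpoly_transpose]

lemma vn_blocks {P : Matrix n n ℂ} {Q : Matrix m m ℂ} (hP : P.IsHermitian) (hQ : Q.IsHermitian) :
    vnEntropy (fromBlocks P 0 0 Q) = vnEntropy P + vnEntropy Q := by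
  rw [vn_eq hP, vn_eq hQ, vn_eq (hP.fromBlocks (by simp) hQ), charpoly_fromBlocks_zero₁₂,
    polyH_mul (charpoly_monic _).ne_zero (charpoly_monic _).ne_zero, add_div]

lemma vn_diagonal (d : n → ℝ) :
    vnEntropy (diagonal fun i => (d i : ℂ)) = (∑ i, Real.negMulLog (d i)) / Real.log 2 := by
  rw [vn_eq, charpoly_diagonal, polyH_prod]
  refine isHermitian_diagonal_of_self_adjoint _ ?_
  ext i; simp

lemma spectral' {ρ : Matrix n n ℂ} (h : ρ.IsHermitian) :
    ρ = (h.eigenvectorUnitary : Matrix n n ℂ) * diagonal (fun i => (h.eigenvalues i : ℂ)) *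
      (h.eigenvectorUnitary : Matrix n n ℂ)ᴴ := by
  exact h.spectral_theorem

lemma unit_l {ρ : Matrix n n ℂ} (h : ρ.IsHermitian) :
    (h.eigenvectorUnitary : Matrix n n ℂ)ᴴ * (h.eigenvectorUnitary : Matrix n n ℂ) = 1 :=
  (Matrix.mem_unitaryGroup_iff').1 h.eigenvectorUnitary.2

lemma unit_r {ρ : Matrix n n ℂ} (h : ρ.IsHermitian) :
    (h.eigenvectorUnitary : Matrix n n ℂ) * (h.eigenvectorUnitary : Matrix n n ℂ)ᴴ = 1 :=
  (Matrix.mem_unitaryGroup_iff).1 h.eigenvectorUnitary.2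

lemma vn_smul {ρ : Matrix n n ℂ} (h : ρ.IsHermitian) (ht : ρ.trace = 1) (c : ℝ) :
    vnEntropy (c • ρ) = c * vnEntropy ρ + Real.negMulLog c / Real.log 2 := by
  have hc : (c • ρ).IsHermitian := by
    unfold Matrix.IsHermitian
    rw [conjTranspose_smul, h.eq]; simp
  have hch : (c • ρ).charpoly = ∏ i, (X - C ((c * h.eigenvalues i : ℝ) : ℂ)) := by
    conv_lhs => rw [spectral' h, ← Matrix.smul_mul, charpoly_mul_comm, ← Matrix.mul_smul,
      ← mul_assoc, unit_l, one_mul]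
    have : (c • diagonal fun i => (h.eigenvalues i : ℂ)) =
        diagonal fun i => ((c * h.eigenvalues i : ℝ) : ℂ) := by
      rw [← diagonal_smul]; congr 1; ext i; simp
    rw [this, charpoly_diagonal]
  have hs : ∑ i, h.eigenvalues i = 1 := by
    have := h.trace_eq_sum_eigenvalues
    rw [ht] at this
    have h2 : ((∑ i, h.eigenvalues i : ℝ) : ℂ) = 1 := by
      rw [this]; push_cast; rfl
    exact_mod_cast h2
  rw [vn_eq hc, hch, polyH_prod, vn_eq_sum h]
  simp only [Real.negMulLog_mul]
  rw [Finset.sum_add_distrib, ← Finset.sum_mul, ← Finset.mul_sum, hs]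
  ring

/-- Peierls-type inequality. -/
lemma vn_le_diag {ρ U : Matrix n n ℂ} (h : ρ.PosSemidef) (hl : Uᴴ * U = 1) (hr : U * Uᴴ = 1) :
    vnEntropy ρ ≤ (∑ j, Real.negMulLog ((Uᴴ * ρ * U) j j).re) / Real.log 2 := by
  rw [vn_eq_sum h.1]
  refine div_le_div_of_nonneg_right ?_ (Real.log_nonneg (by norm_num))
  set V : Matrix n n ℂ := (h.1.eigenvectorUnitary : Matrix n n ℂ) with hV
  set W : Matrix n n ℂ := Vᴴ * U with hW
  have hWl : Wᴴ * W = 1 := by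
    rw [hW, conjTranspose_mul, conjTranspose_conjTranspose, mul_assoc, ← mul_assoc V,
      unit_r, one_mul, hl]
  have hWr : W * Wᴴ = 1 := by
    rw [hW, conjTranspose_mul, conjTranspose_conjTranspose, mul_assoc, ← mul_assoc U, hr,
      one_mul, unit_l]
  have hcol : ∀ j, ∑ i, Complex.normSq (W i j) = 1 := by
    intro j
    have := congrFun (congrFun hWl j) j
    simp only [mul_apply, conjTranspose_apply, one_apply_eq, Complex.star_def,
      ← Complex.normSq_eq_conj_mul_self] at this
    exact_mod_cast this
  have hrow : ∀ i, ∑ j, Complex.normSq (W i j) = 1 := by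
    intro i
    have := congrFun (congrFun hWr i) i
    simp only [mul_apply, conjTranspose_apply, one_apply_eq, Complex.star_def,
      Complex.mul_conj] at this
    exact_mod_cast this
  have hd : ∀ j, ((Uᴴ * ρ * U) j j).re =
      ∑ i, Complex.normSq (W i j) • h.1.eigenvalues i := by
    intro j
    have e : Uᴴ * ρ * U = Wᴴ * (diagonal (fun i => (h.1.eigenvalues i : ℂ)) * W) := by
      conv_lhs => rw [spectral' h.1]
      rw [hW, conjTranspose_mul, conjTranspose_conjTranspose]
      simp only [mul_assoc, hV]
    rw [e, mul_apply, Complex.re_sum]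
    refine Finset.sum_congr rfl fun i _ => ?_
    rw [diagonal_mul, conjTranspose_apply]
    generalize W i j = w
    generalize h.1.eigenvalues i = x
    simp [Complex.normSq_apply]
    ring
  calc ∑ i, Real.negMulLog (h.1.eigenvalues i)
      = ∑ i, ∑ j, Complex.normSq (W i j) • Real.negMulLog (h.1.eigenvalues i) := by
        refine Finset.sum_congr rfl fun i _ => ?_
        rw [← Finset.sum_smul, hrow, one_smul]
    _ = ∑ j, ∑ i, Complex.normSq (W i j) • Real.negMulLog (h.1.eigenvalues i) :=
        Finset.sum_comm
    _ ≤ _ := by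
        refine Finset.sum_le_sum fun j _ => ?_
        rw [hd]
        exact Real.concaveOn_negMulLog.le_map_sum (fun i _ => Complex.normSq_nonneg _) (hcol j)
          (fun i _ => h.eigenvalues_nonneg i)

lemma vn_concave {ρ P Q : Matrix n n ℂ} (hρ : ρ.IsHermitian) (hP : P.PosSemidef)
    (hQ : Q.PosSemidef) (h : P + Q = (2 : ℂ) • ρ) :
    vnEntropy P + vnEntropy Q ≤ 2 * vnEntropy ρ := by
  set U : Matrix n n ℂ := (hρ.eigenvectorUnitary : Matrix n n ℂ) with hU
  have h1 := vn_le_diag hP (unit_l hρ) (unit_r hρ)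
  have h2 := vn_le_diag hQ (unit_l hρ) (unit_r hρ)
  refine (add_le_add h1 h2).trans ?_
  rw [vn_eq_sum hρ, ← add_div, ← mul_div_assoc]
  refine div_le_div_of_nonneg_right ?_ (Real.log_nonneg (by norm_num))
  rw [← Finset.sum_add_distrib, Finset.mul_sum]
  refine Finset.sum_le_sum fun j _ => ?_
  rw [← hU]
  have hp : 0 ≤ ((Uᴴ * P * U) j j).re :=
    (Complex.le_def.1 ((hP.conjTranspose_mul_mul_same U).diag_nonneg (i := j))).1
  have hq : 0 ≤ ((Uᴴ * Q * U) j j).re :=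
    (Complex.le_def.1 ((hQ.conjTranspose_mul_mul_same U).diag_nonneg (i := j))).1
  have hsum : ((Uᴴ * P * U) j j).re + ((Uᴴ * Q * U) j j).re = 2 * hρ.eigenvalues j := by
    rw [← Complex.add_re, ← Matrix.add_apply, ← add_mul, ← mul_add, h, Matrix.mul_smul,
      Matrix.smul_mul]
    have : Uᴴ * ρ * U = diagonal (fun i => (hρ.eigenvalues i : ℂ)) := by
      conv_lhs => rw [spectral' hρ]
      rw [← hU]
      calc _ = (Uᴴ * U) * diagonal (fun i => (hρ.eigenvalues i : ℂ)) * (Uᴴ * U) := by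
            simp only [mul_assoc]
        _ = _ := by rw [hU, unit_l]; simp
    rw [this]; simp
  have := Real.concaveOn_negMulLog.2 (Set.mem_Ici.2 hp) (Set.mem_Ici.2 hq)
    (by norm_num : (0:ℝ) ≤ 1/2) (by norm_num : (0:ℝ) ≤ 1/2) (by norm_num)
  simp only [smul_eq_mul] at this
  have e : 1 / 2 * ((Uᴴ * P * U) j j).re + 1 / 2 * ((Uᴴ * Q * U) j j).re =
      hρ.eigenvalues j := by linarith
  rw [e] at this
  linarith

variable {A B : Matrix m n ℂ}

lemma vn_sum_B (h : A * Bᴴ = 0) :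
    vnEntropy (Aᴴ * A + Bᴴ * B) = vnEntropy (A * Aᴴ) + vnEntropy (B * Bᴴ) := by
  have h' : B * Aᴴ = 0 := by
    have := congrArg conjTranspose h
    simpa [conjTranspose_mul] using this
  rw [← vn_blocks (isHermitian_mul_conjTranspose_self A) (isHermitian_mul_conjTranspose_self B)]
  have := vn_mul_comm (fromRows A B)
  rw [conjTranspose_fromRows_eq_fromCols_conjTranspose, fromRows_mul_fromCols,
    fromCols_mul_fromRows, h, h'] at this
  exact this.symm

lemma vn_sum_le (h : A * Bᴴ = 0) :
    vnEntropy (A * Aᴴ + B * Bᴴ) ≤ vnEntropy (Aᴴ * A + Bᴴ * B) := by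
  have h' : B * Aᴴ = 0 := by
    have := congrArg conjTranspose h
    simpa [conjTranspose_mul] using this
  have e1 : (A + B) * (A + B)ᴴ = A * Aᴴ + B * Bᴴ := by
    simp [Matrix.add_mul, Matrix.mul_add, h, h']
  have e2 : (A - B) * (A - B)ᴴ = A * Aᴴ + B * Bᴴ := by
    simp [Matrix.sub_mul, Matrix.mul_sub, h, h']
  have := vn_concave (ρ := Aᴴ * A + Bᴴ * B)
    ((isHermitian_conjTranspose_mul_self A).add (isHermitian_conjTranspose_mul_self B))
    (posSemidef_conjTranspose_mul_self (A + B)) (posSemidef_conjTranspose_mul_self (A - B)) (by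
      rw [two_smul]
      simp only [conjTranspose_add, conjTranspose_sub, Matrix.add_mul, Matrix.mul_add,
        Matrix.sub_mul, Matrix.mul_sub]
      abel)
  rw [← vn_mul_comm, ← vn_mul_comm, e1, e2] at this
  linarith

end gen

/-- Coefficient matrix of a vector. -/
def mat (ψ : TensorSpace dA dB) : Matrix (Fin dA) (Fin dB) ℂ := fun a b => ψ (a, b)

lemma trB_ketbra (ψ : TensorSpace dA dB) : trB (ketbra ψ) = mat ψ * (mat ψ)ᴴ := by
  ext a a'; simp [trB, ketbra, mat, mul_apply]

lemma trA_ketbra (ψ : TensorSpace dA dB) : trA (ketbra ψ) = ((mat ψ)ᴴ * mat ψ)ᵀ := by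
  ext a a'; simp [trA, ketbra, mat, mul_apply, mul_comm]

lemma trB_add (ρ σ : Matrix (Fin dA × Fin dB) (Fin dA × Fin dB) ℂ) :
    trB (ρ + σ) = trB ρ + trB σ := by
  ext a a'; simp [trB, Finset.sum_add_distrib]

lemma trA_add (ρ σ : Matrix (Fin dA × Fin dB) (Fin dA × Fin dB) ℂ) :
    trA (ρ + σ) = trA ρ + trA σ := by
  ext a a'; simp [trA, Finset.sum_add_distrib]

lemma ketbra_smul (α : ℂ) (ψ : TensorSpace dA dB) :
    ketbra (α • ψ) = (‖α‖ ^ 2 : ℝ) • ketbra ψ := by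
  ext p q
  simp only [ketbra, PiLp.smul_apply, smul_eq_mul, map_mul, Matrix.smul_apply, Complex.real_smul]
  rw [← Complex.normSq_eq_norm_sq, Complex.normSq_eq_conj_mul_self]
  ring

lemma mat_smul (α : ℂ) (ψ : TensorSpace dA dB) : mat (α • ψ) = α • mat ψ := by
  ext; simp [mat]

lemma mat_add (ψ φ : TensorSpace dA dB) : mat (ψ + φ) = mat ψ + mat φ := by
  ext; simp [mat]

lemma trace_mat (ψ φ : TensorSpace dA dB) :
    (mat ψ * (mat φ)ᴴ).trace = inner ℂ φ ψ := by
  simp [trace, mul_apply, mat, PiLp.inner_apply, Fintype.sum_prod_type]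

lemma mat_orth {Ψ Φ : TensorSpace dA dB} (h : OneSidedOrthB Ψ Φ) : mat Ψ * (mat Φ)ᴴ = 0 := by
  unfold OneSidedOrthB at h
  rw [trA_ketbra, trA_ketbra, ← transpose_mul, trace_transpose] at h
  rw [← trace_conjTranspose_mul_self_eq_zero_iff, ← h, conjTranspose_mul,
    conjTranspose_conjTranspose, Matrix.mul_assoc, trace_mul_comm, trace_mul_comm ((mat Φ)ᴴ * mat Φ)]
  simp only [Matrix.mul_assoc]

lemma vn_ketbra_add {Ψ Φ : TensorSpace dA dB} (h : inner ℂ Ψ Φ = (0 : ℂ)) :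
    vnEntropy (ketbra Ψ + ketbra Φ) =
      Real.negMulLog (‖Ψ‖ ^ 2) / Real.log 2 + Real.negMulLog (‖Φ‖ ^ 2) / Real.log 2 := by
  have h' : inner ℂ Φ Ψ = (0 : ℂ) := by rw [← inner_conj_symm, h]; simp
  let F : Matrix (Fin dA × Fin dB) (Fin 2) ℂ := Matrix.of fun p i => ![Ψ p, Φ p] i
  have e1 : ketbra Ψ + ketbra Φ = F * Fᴴ := by
    ext p q; simp [F, ketbra, mul_apply, Fin.sum_univ_two]
  have e2 : Fᴴ * F = diagonal fun i => ((![‖Ψ‖ ^ 2, ‖Φ‖ ^ 2] i : ℝ) : ℂ) := by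
    have key : ∀ ψ φ : TensorSpace dA dB, ∑ p, (starRingEnd ℂ) (ψ p) * φ p = inner ℂ ψ φ := by
      intro ψ φ; simp [PiLp.inner_apply, mul_comm]
    ext i j
    fin_cases i <;> fin_cases j <;> simp [F, mul_apply, key, h, h', inner_self_eq_norm_sq_to_K]
  rw [e1, vn_mul_comm, e2, vn_diagonal]
  simp [Fin.sum_univ_two, add_div]

lemma herm_trB (ψ : TensorSpace dA dB) : (trB (ketbra ψ)).IsHermitian := by
  rw [trB_ketbra]; exact isHermitian_mul_conjTranspose_self _

lemma trace_trB {ψ : TensorSpace dA dB} (h : ‖ψ‖ = 1) : (trB (ketbra ψ)).trace = 1 := by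
  rw [trB_ketbra, trace_mat, inner_self_eq_norm_sq_to_K, h]; simp

lemma trB_smul (c : ℝ) (ρ : Matrix (Fin dA × Fin dB) (Fin dA × Fin dB) ℂ) :
    trB (c • ρ) = c • trB ρ := by
  ext; simp [trB, Finset.mul_sum]

/-- Theorem 1 of the paper: entanglement of a superposition of
one-sided orthogonal states. -/
theorem ent_superposition_one_sided {dA dB : ℕ}
    (Ψ Φ : TensorSpace dA dB) (hΨ : ‖Ψ‖ = 1) (hΦ : ‖Φ‖ = 1)
    (horth : OneSidedOrthB Ψ Φ) (α β : ℂ) (hαβ : ‖α‖ ^ 2 + ‖β‖ ^ 2 = 1) :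
    ‖α • Ψ + β • Φ‖ = 1 ∧
    ent (α • Ψ + β • Φ) =
      vnEntropy (trB ((‖α‖ ^ 2 : ℝ) • ketbra Ψ + (‖β‖ ^ 2 : ℝ) • ketbra Φ)) ∧
    vnEntropy (trB ((‖α‖ ^ 2 : ℝ) • ketbra Ψ + (‖β‖ ^ 2 : ℝ) • ketbra Φ)) =
      ‖α‖ ^ 2 * ent Ψ + ‖β‖ ^ 2 * ent Φ
      + vnEntropy ((‖α‖ ^ 2 : ℝ) • ketbra Ψ + (‖β‖ ^ 2 : ℝ) • ketbra Φ)
      - |vnEntropy (trB ((‖α‖ ^ 2 : ℝ) • ketbra Ψ + (‖β‖ ^ 2 : ℝ) • ketbra Φ))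
         - vnEntropy (trA ((‖α‖ ^ 2 : ℝ) • ketbra Ψ + (‖β‖ ^ 2 : ℝ) • ketbra Φ))| := by
  have hM := mat_orth horth
  have hin : inner ℂ Φ Ψ = (0 : ℂ) := by rw [← trace_mat, hM]; simp
  have hin' : inner ℂ Ψ Φ = (0 : ℂ) := by rw [← inner_conj_symm, hin]; simp
  have hinab : inner ℂ (α • Ψ) (β • Φ) = (0 : ℂ) := by
    rw [inner_smul_left, inner_smul_right, hin']; simp
  have hAB : mat (α • Ψ) * (mat (β • Φ))ᴴ = 0 := by
    rw [mat_smul, mat_smul, conjTranspose_smul, Matrix.smul_mul, Matrix.mul_smul, hM]; simp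
  have hBA : mat (β • Φ) * (mat (α • Ψ))ᴴ = 0 := by
    have := congrArg conjTranspose hAB
    simpa [conjTranspose_mul] using this
  have hEα : vnEntropy (mat (α • Ψ) * (mat (α • Ψ))ᴴ) =
      ‖α‖ ^ 2 * ent Ψ + Real.negMulLog (‖α‖ ^ 2) / Real.log 2 := by
    rw [← trB_ketbra, ketbra_smul, trB_smul, vn_smul (herm_trB Ψ) (trace_trB hΨ), ent]
  have hEβ : vnEntropy (mat (β • Φ) * (mat (β • Φ))ᴴ) =
      ‖β‖ ^ 2 * ent Φ + Real.negMulLog (‖β‖ ^ 2) / Real.log 2 := by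
    rw [← trB_ketbra, ketbra_smul, trB_smul, vn_smul (herm_trB Φ) (trace_trB hΦ), ent]
  have hS := vn_sum_B hAB
  have hle := vn_sum_le hAB
  have hABs := vn_ketbra_add hinab
  rw [norm_smul, norm_smul, hΨ, hΦ, mul_one, mul_one] at hABs
  rw [← ketbra_smul, ← ketbra_smul]
  refine ⟨?_, ?_, ?_⟩
  · have h1 := norm_add_sq_eq_norm_sq_add_norm_sq_of_inner_eq_zero (𝕜 := ℂ) (α • Ψ) (β • Φ) hinab
    rw [norm_smul, norm_smul, hΨ, hΦ, mul_one, mul_one] at h1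
    have h2 : ‖α • Ψ + β • Φ‖ ^ 2 = 1 := by nlinarith
    exact (pow_eq_one_iff_of_nonneg (norm_nonneg _) (by norm_num)).1 h2
  · rw [ent, trB_add, trB_ketbra, trB_ketbra, trB_ketbra, mat_add]
    congr 1
    simp [Matrix.add_mul, Matrix.mul_add, hAB, hBA]
  · rw [trB_add, trA_add, trB_ketbra, trB_ketbra, trA_ketbra, trA_ketbra, ← transpose_add,
      vn_transpose ((isHermitian_conjTranspose_mul_self _).add
        (isHermitian_conjTranspose_mul_self _)), abs_of_nonpos (by linarith), hABs]
    linarith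

end EoS
end
end

section
/- (LPS bound.) Let Ψ and Φ be unit vectors in H = ℂ^{d_A} ⊗ ℂ^{d_B} and let α, β ∈ ℂ with |α|² + |β|² = 1 be such that Γ = αΨ + βΦ ≠ 0. Then ‖Γ‖² · E(Γ) ≤ 2( |α|²E(Ψ) + |β|²E(Φ) + h₂(|α|²) ). -/
open scoped BigOperators

noncomputable section

namespace EoS

variable {dA dB : ℕ}

open scoped ComplexOrder

/-- The real quadratic form of a matrix. -/
def quad {n : Type*} [Fintype n] [DecidableEq n] (A : Matrix n n ℂ) (x : EuclideanSpace ℂ n) : ℝ :=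
  (inner ℂ x (Matrix.toEuclideanLin A x)).re

section
variable {n : Type*} [Fintype n] [DecidableEq n]

theorem quad_comb (p q : ℝ) (A B : Matrix n n ℂ) (x : EuclideanSpace ℂ n) :
    quad ((p : ℂ) • A + (q : ℂ) • B) x = p * quad A x + q * quad B x := by
  unfold quad
  rw [map_add, map_smul, map_smul, LinearMap.add_apply, LinearMap.smul_apply, LinearMap.smul_apply,
    inner_add_right, inner_smul_right, inner_smul_right]
  simp

theorem quad_eig {A : Matrix n n ℂ} (hA : A.IsHermitian) (x : EuclideanSpace ℂ n) :
    quad A x = ∑ i, hA.eigenvalues i * ‖inner ℂ (hA.eigenvectorBasis i) x‖ ^ 2 := by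
  have hs : ∀ i, inner ℂ (hA.eigenvectorBasis i) (Matrix.toEuclideanLin A x)
      = (hA.eigenvalues i : ℂ) * inner ℂ (hA.eigenvectorBasis i) x := by
    intro i
    rw [← (Matrix.isSymmetric_toEuclideanLin_iff.2 hA) (hA.eigenvectorBasis i) x]
    have : Matrix.toEuclideanLin A (hA.eigenvectorBasis i)
        = (hA.eigenvalues i : ℂ) • hA.eigenvectorBasis i := by
      ext j
      have := congrFun (hA.mulVec_eigenvectorBasis i) j
      simpa [Matrix.toLpLin_apply] using this
    rw [this, inner_smul_left]
    simp
  unfold quad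
  rw [← hA.eigenvectorBasis.sum_inner_mul_inner, Complex.re_sum]
  refine Finset.sum_congr rfl fun i _ => ?_
  rw [hs, mul_left_comm, ← inner_conj_symm x, Complex.conj_mul']
  norm_cast

theorem quad_eig_self {A : Matrix n n ℂ} (hA : A.IsHermitian) (i : n) :
    quad A (hA.eigenvectorBasis i) = hA.eigenvalues i := by
  rw [quad_eig hA, Finset.sum_eq_single i]
  · simp
  · intro j _ hj
    rw [hA.eigenvectorBasis.orthonormal.2 hj]; simp
  · simp

theorem peierls {A : Matrix n n ℂ} (hA : A.PosSemidef)
    (u : OrthonormalBasis n ℂ (EuclideanSpace ℂ n)) :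
    ∑ i, Real.negMulLog (hA.1.eigenvalues i) ≤ ∑ i, Real.negMulLog (quad A (u i)) := by
  have h1 : ∀ i, ∑ j, ‖inner ℂ (hA.1.eigenvectorBasis j) (u i)‖ ^ 2 *
      Real.negMulLog (hA.1.eigenvalues j) ≤ Real.negMulLog (quad A (u i)) := by
    intro i
    have := Real.concaveOn_negMulLog.le_map_sum (t := Finset.univ)
      (w := fun j => ‖inner ℂ (hA.1.eigenvectorBasis j) (u i)‖ ^ 2)
      (p := hA.1.eigenvalues) (fun _ _ => by positivity)
      (by rw [OrthonormalBasis.sum_sq_norm_inner_right]; simp)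
      (fun j _ => hA.eigenvalues_nonneg j)
    rw [quad_eig hA.1]
    simpa [mul_comm] using this
  refine le_trans (le_of_eq ?_) (Finset.sum_le_sum fun i _ => h1 i)
  rw [Finset.sum_comm]
  refine Finset.sum_congr rfl fun j _ => ?_
  rw [← Finset.sum_mul, OrthonormalBasis.sum_sq_norm_inner_left]
  simp

theorem quad_nonneg {A : Matrix n n ℂ} (hA : A.PosSemidef) (x : EuclideanSpace ℂ n) :
    0 ≤ quad A x := by
  rw [quad_eig hA.1]
  exact Finset.sum_nonneg fun i _ => mul_nonneg (hA.eigenvalues_nonneg i) (by positivity)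

/-- natural-log entropy -/
def S {A : Matrix n n ℂ} (hA : A.PosSemidef) : ℝ := ∑ i, Real.negMulLog (hA.1.eigenvalues i)

theorem S_concave {A B C : Matrix n n ℂ} (hA : A.PosSemidef) (hB : B.PosSemidef)
    (hC : C.PosSemidef) (p q : ℝ) (hp : 0 ≤ p) (hq : 0 ≤ q) (hpq : p + q = 1)
    (h : C = (p : ℂ) • A + (q : ℂ) • B) : p * S hA + q * S hB ≤ S hC := by
  set u := hC.1.eigenvectorBasis with hu
  calc p * S hA + q * S hB ≤ p * ∑ i, Real.negMulLog (quad A (u i))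
        + q * ∑ i, Real.negMulLog (quad B (u i)) := by
        gcongr
        · exact peierls hA u
        · exact peierls hB u
    _ = ∑ i, (p * Real.negMulLog (quad A (u i)) + q * Real.negMulLog (quad B (u i))) := by
        rw [Finset.sum_add_distrib, Finset.mul_sum, Finset.mul_sum]
    _ ≤ S hC := by
        refine Finset.sum_le_sum fun i _ => ?_
        rw [← quad_eig_self hC.1 i]
        have e : quad C (hC.1.eigenvectorBasis i) = p * quad A (u i) + q * quad B (u i) := by
          rw [← hu, ← quad_comb, ← h]
        rw [e]
        exact Real.concaveOn_negMulLog.2 (quad_nonneg hA _) (quad_nonneg hB _) hp hq hpq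

theorem S_le_of_decomp {C : Matrix n n ℂ} (hC : C.PosSemidef) {K : Type*} [Fintype K]
    (w : K → EuclideanSpace ℂ n) (h : ∀ x, quad C x = ∑ k, ‖inner ℂ (w k) x‖ ^ 2) :
    S hC ≤ ∑ k, Real.negMulLog (‖w k‖ ^ 2) := by
  set e := hC.1.eigenvectorBasis with he
  set s := hC.1.eigenvalues with hs
  have hs0 : ∀ i, 0 ≤ s i := hC.eigenvalues_nonneg
  let m : n → K → ℝ := fun i k => ‖inner ℂ (w k) (e i)‖ ^ 2
  have hm0 : ∀ i k, 0 ≤ m i k := fun i k => by positivity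
  have hms : ∀ i, ∑ k, m i k = s i := fun i => by
    rw [hs, ← quad_eig_self hC.1 i, h]
  have hmt : ∀ k, ∑ i, m i k = ‖w k‖ ^ 2 := fun k =>
    OrthonormalBasis.sum_sq_norm_inner_left _ _
  have hmz : ∀ i k, s i = 0 → m i k = 0 := fun i k h0 => by
    have := hms i
    rw [h0, Finset.sum_eq_zero_iff_of_nonneg (fun k _ => hm0 i k)] at this
    exact this k (Finset.mem_univ _)
  have hc : ∀ k, ∑ i, m i k / s i ≤ 1 := by
    intro k
    set c := ∑ i, m i k / s i with hcdef
    have hc0 : 0 ≤ c := Finset.sum_nonneg fun i _ => div_nonneg (hm0 i k) (hs0 i)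
    let x : EuclideanSpace ℂ n := ∑ i, (((s i)⁻¹ : ℝ) * inner ℂ (e i) (w k) : ℂ) • e i
    have hx : ∀ i, inner ℂ (e i) x = (((s i)⁻¹ : ℝ) * inner ℂ (e i) (w k) : ℂ) := fun i =>
      e.orthonormal.inner_right_fintype _ i
    have hsym : ∀ i, ‖inner ℂ (e i) (w k)‖ ^ 2 = m i k := fun i => by
      simp only [m]; rw [norm_inner_symm]
    have h1 : quad C x = c := by
      rw [quad_eig hC.1]
      refine Finset.sum_congr rfl fun i _ => ?_
      rw [← he, hx, norm_mul, mul_pow, hsym, Complex.norm_real, Real.norm_eq_abs, sq_abs, ← hs]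
      by_cases h0 : s i = 0
      · simp [h0]
      · field_simp
    have h2 : inner ℂ (w k) x = (c : ℂ) := by
      rw [inner_sum, hcdef, Complex.ofReal_sum]
      refine Finset.sum_congr rfl fun i _ => ?_
      rw [inner_smul_right, mul_assoc, ← inner_conj_symm (w k) (e i), Complex.mul_conj',
        ← Complex.ofReal_pow, hsym]
      push_cast
      ring
    have h3 : c ^ 2 ≤ c := by
      rw [← h1, h x] 
      have := Finset.single_le_sum (f := fun k => ‖inner ℂ (w k) x‖ ^ 2)
        (fun k _ => by positivity) (Finset.mem_univ k)
      rw [← h x, h1]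
      rw [← h x, h1] at this
      simpa [h2] using this
    nlinarith
  have hj : ∀ k, ∑ i, m i k / s i * Real.negMulLog (s i) ≤ Real.negMulLog (‖w k‖ ^ 2) := by
    intro k
    have := Real.concaveOn_negMulLog.map_add_sum_le (t := Finset.univ)
      (w := fun i => m i k / s i) (p := s) (v := 1 - ∑ i, m i k / s i) (q := 0)
      (fun i _ => div_nonneg (hm0 i k) (hs0 i)) (by ring) (fun i _ => hs0 i)
      (by linarith [hc k]) (by simp)
    have e2 : ∑ i, m i k / s i * s i = ‖w k‖ ^ 2 := by
      rw [← hmt]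
      refine Finset.sum_congr rfl fun i _ => ?_
      by_cases h0 : s i = 0
      · simp [h0, hmz i k h0]
      · field_simp
    simp only [smul_eq_mul, Real.negMulLog_zero, mul_zero, zero_add, e2] at this
    exact this
  refine le_trans (le_of_eq ?_) (Finset.sum_le_sum fun k _ => hj k)
  rw [Finset.sum_comm]
  refine Finset.sum_congr rfl fun i _ => ?_
  rw [← Finset.sum_mul, ← Finset.sum_div, hms]
  by_cases h0 : s i = 0
  · rw [← hs, h0]; simp
  · rw [div_self h0, one_mul]

theorem S_mix_le {A B C : Matrix n n ℂ} (hA : A.PosSemidef) (hB : B.PosSemidef)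
    (hC : C.PosSemidef) (hA1 : ∑ i, hA.1.eigenvalues i = 1) (hB1 : ∑ i, hB.1.eigenvalues i = 1)
    (p q : ℝ) (hp : 0 ≤ p) (hq : 0 ≤ q)
    (h : C = (p : ℂ) • A + (q : ℂ) • B) :
    S hC ≤ p * S hA + q * S hB + Real.negMulLog p + Real.negMulLog q := by
  have key := S_le_of_decomp hC (K := n ⊕ n)
    (Sum.elim (fun i => ((Real.sqrt (p * hA.1.eigenvalues i) : ℝ) : ℂ) • hA.1.eigenvectorBasis i)
      (fun i => ((Real.sqrt (q * hB.1.eigenvalues i) : ℝ) : ℂ) • hB.1.eigenvectorBasis i))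
    (by
      intro x
      rw [h, quad_comb, quad_eig hA.1, quad_eig hB.1, Fintype.sum_sum_type, Finset.mul_sum,
        Finset.mul_sum]
      congr 1
      · refine Finset.sum_congr rfl fun i _ => ?_
        simp only [Sum.elim_inl]
        rw [inner_smul_left, norm_mul, mul_pow, RCLike.norm_conj, Complex.norm_real,
          Real.norm_eq_abs, sq_abs, Real.sq_sqrt (mul_nonneg hp (hA.eigenvalues_nonneg i))]
        ring
      · refine Finset.sum_congr rfl fun i _ => ?_
        simp only [Sum.elim_inr]
        rw [inner_smul_left, norm_mul, mul_pow, RCLike.norm_conj, Complex.norm_real,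
          Real.norm_eq_abs, sq_abs, Real.sq_sqrt (mul_nonneg hq (hB.eigenvalues_nonneg i))]
        ring)
  refine key.trans (le_of_eq ?_)
  have aux : ∀ (r : ℝ) (hr : 0 ≤ r) (D : Matrix n n ℂ) (hD : D.PosSemidef)
      (_ : ∑ i, hD.1.eigenvalues i = 1),
      ∑ i, Real.negMulLog
        (‖((Real.sqrt (r * hD.1.eigenvalues i) : ℝ) : ℂ) • hD.1.eigenvectorBasis i‖ ^ 2)
        = r * S hD + Real.negMulLog r := by
    intro r hr D hD h1
    have : ∀ i, Real.negMulLog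
        (‖((Real.sqrt (r * hD.1.eigenvalues i) : ℝ) : ℂ) • hD.1.eigenvectorBasis i‖ ^ 2)
        = hD.1.eigenvalues i * Real.negMulLog r + r * Real.negMulLog (hD.1.eigenvalues i) := by
      intro i
      rw [norm_smul, OrthonormalBasis.norm_eq_one, mul_one, Complex.norm_real, Real.norm_eq_abs,
        sq_abs, Real.sq_sqrt (mul_nonneg hr (hD.eigenvalues_nonneg i)), Real.negMulLog_mul]
    simp only [this]
    rw [Finset.sum_add_distrib, ← Finset.sum_mul, h1, ← Finset.mul_sum, S]
    ring
  rw [Fintype.sum_sum_type]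
  simp only [Sum.elim_inl, Sum.elim_inr]
  rw [aux p hp A hA hA1, aux q hq B hB hB1]
  ring

theorem vn_eq_s6 {A : Matrix n n ℂ} (hA : A.PosSemidef) : vnEntropy A = S hA / Real.log 2 := by
  unfold vnEntropy
  rw [dif_pos hA.1, S, Finset.sum_div, ← Finset.sum_neg_distrib]
  refine Finset.sum_congr rfl fun i _ => ?_
  rw [Real.negMulLog, Real.logb]
  ring

theorem S_nonneg {A : Matrix n n ℂ} (hA : A.PosSemidef) (h : ∑ i, hA.1.eigenvalues i ≤ 1) :
    0 ≤ S hA :=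
  Finset.sum_nonneg fun i _ => Real.negMulLog_nonneg (hA.eigenvalues_nonneg i)
    ((Finset.single_le_sum (fun j _ => hA.eigenvalues_nonneg j) (Finset.mem_univ i)).trans h)

end

theorem psd (ψ : TensorSpace dA dB) : (trB (ketbra ψ)).PosSemidef := by
  have : trB (ketbra ψ) = (Matrix.of fun a b => ψ (a, b)) * (Matrix.of fun a b => ψ (a, b)).conjTranspose := by
    ext a a'
    simp [trB, ketbra, Matrix.mul_apply]
  rw [this]
  exact Matrix.posSemidef_self_mul_conjTranspose _

theorem sum_eig (ψ : TensorSpace dA dB) : ∑ i, (psd ψ).1.eigenvalues i = ‖ψ‖ ^ 2 := by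
  have h := (psd ψ).1.trace_eq_sum_eigenvalues
  have h2 : (trB (ketbra ψ)).trace = ((‖ψ‖ ^ 2 : ℝ) : ℂ) := by
    rw [EuclideanSpace.norm_sq_eq, Fintype.sum_prod_type]
    simp [Matrix.trace, trB, ketbra, Complex.mul_conj']
  rw [h2] at h
  have h3 := congrArg Complex.re h
  simp only [Complex.coe_algebraMap] at h3
  rw [← Complex.ofReal_sum] at h3
  exact h3.symm

theorem trB_scale (c : ℝ) (ψ : TensorSpace dA dB) :
    trB (ketbra (c • ψ)) = ((c ^ 2 : ℝ) : ℂ) • trB (ketbra ψ) := by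
  ext a a'
  simp [trB, ketbra, Finset.mul_sum]
  refine Finset.sum_congr rfl fun i _ => ?_
  ring

theorem trB_normed (ψ : TensorSpace dA dB) :
    ((‖ψ‖ ^ 2 / 2 : ℝ) : ℂ) • trB (ketbra ((‖ψ‖ : ℝ)⁻¹ • ψ)) = (1 / 2 : ℂ) • trB (ketbra ψ) := by
  by_cases h : ψ = 0
  · subst h
    ext a a'
    simp [trB, ketbra]
  · have h' : ‖ψ‖ ≠ 0 := norm_ne_zero_iff.2 h
    rw [trB_scale, smul_smul, ← Complex.ofReal_mul]
    congr 1
    have : ‖ψ‖ ^ 2 / 2 * ‖ψ‖⁻¹ ^ 2 = 1 / 2 := by field_simp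
    rw [this]; norm_num

theorem par (Ψ Φ : TensorSpace dA dB) (α β : ℂ) :
    (1 / 2 : ℂ) • trB (ketbra (α • Ψ + β • Φ)) + (1 / 2 : ℂ) • trB (ketbra (α • Ψ - β • Φ))
      = ((‖α‖ ^ 2 : ℝ) : ℂ) • trB (ketbra Ψ) + ((‖β‖ ^ 2 : ℝ) : ℂ) • trB (ketbra Φ) := by
  ext a a'
  push_cast
  rw [← Complex.mul_conj', ← Complex.mul_conj']
  simp only [trB, ketbra, Matrix.add_apply, Matrix.smul_apply, smul_eq_mul, Finset.mul_sum,
    ← Finset.sum_add_distrib]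
  refine Finset.sum_congr rfl fun i _ => ?_
  simp
  ring

theorem norm_inv_le (ψ : TensorSpace dA dB) : ‖(‖ψ‖ : ℝ)⁻¹ • ψ‖ ^ 2 ≤ 1 := by
  rw [norm_smul, norm_inv, norm_norm]
  by_cases h : ‖ψ‖ = 0
  · simp [h]
  · rw [inv_mul_cancel₀ h]; simp

/-- the LPS bound:
`‖Γ‖² E(Γ) ≤ 2(|α|²E(Ψ) + |β|²E(Φ) + h₂(|α|²))`. -/
theorem lps_bound {dA dB : ℕ}
    (Ψ Φ : TensorSpace dA dB) (hΨ : ‖Ψ‖ = 1) (hΦ : ‖Φ‖ = 1)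
    (α β : ℂ) (hαβ : ‖α‖ ^ 2 + ‖β‖ ^ 2 = 1) (hΓ : α • Ψ + β • Φ ≠ 0) :
    ‖α • Ψ + β • Φ‖ ^ 2 * entN (α • Ψ + β • Φ)
      ≤ 2 * (‖α‖ ^ 2 * ent Ψ + ‖β‖ ^ 2 * ent Φ + h2 (‖α‖ ^ 2)) := by
  set Γ := α • Ψ + β • Φ with hΓd
  set Δ := α • Ψ - β • Φ with hΔd
  have hnorm : ‖Γ‖ ^ 2 / 2 + ‖Δ‖ ^ 2 / 2 = 1 := by
    have := parallelogram_law_with_norm ℂ (α • Ψ) (β • Φ)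
    rw [norm_smul, norm_smul, hΨ, hΦ, ← hΓd, ← hΔd] at this
    nlinarith
  set C := ((‖α‖ ^ 2 : ℝ) : ℂ) • trB (ketbra Ψ) + ((‖β‖ ^ 2 : ℝ) : ℂ) • trB (ketbra Φ) with hCd
  have hC : C.PosSemidef := by
    refine ((psd Ψ).smul ?_).add ((psd Φ).smul ?_)
    · exact_mod_cast sq_nonneg ‖α‖
    · exact_mod_cast sq_nonneg ‖β‖
  have h1 := S_concave (psd ((‖Γ‖ : ℝ)⁻¹ • Γ)) (psd ((‖Δ‖ : ℝ)⁻¹ • Δ)) hC (‖Γ‖ ^ 2 / 2)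
    (‖Δ‖ ^ 2 / 2) (by positivity) (by positivity) hnorm
    (by rw [trB_normed, trB_normed, hΓd, hΔd, par])
  have hmix := S_mix_le (psd Ψ) (psd Φ) hC (by rw [sum_eig, hΨ]; norm_num)
    (by rw [sum_eig, hΦ]; norm_num) (‖α‖ ^ 2) (‖β‖ ^ 2) (by positivity) (by positivity) hCd
  have h3 : 0 ≤ ‖Δ‖ ^ 2 / 2 * S (psd ((‖Δ‖ : ℝ)⁻¹ • Δ)) :=
    mul_nonneg (by positivity) (S_nonneg _ (by rw [sum_eig]; exact norm_inv_le _))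
  have h4 : h2 (‖α‖ ^ 2) = (Real.negMulLog (‖α‖ ^ 2) + Real.negMulLog (‖β‖ ^ 2)) / Real.log 2 := by
    have : 1 - ‖α‖ ^ 2 = ‖β‖ ^ 2 := by linarith
    rw [EoS.h2, this, Real.negMulLog, Real.negMulLog, Real.logb, Real.logb]
    ring
  rw [entN, ent, ent, ent, vn_eq_s6 (psd _), vn_eq_s6 (psd _), vn_eq_s6 (psd _), h4]
  have hl : 0 < Real.log 2 := Real.log_pos (by norm_num)
  have h5 : ‖Γ‖ ^ 2 * S (psd ((‖Γ‖ : ℝ)⁻¹ • Γ)) ≤ 2 * (‖α‖ ^ 2 * S (psd Ψ) + ‖β‖ ^ 2 * S (psd Φ)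
      + (Real.negMulLog (‖α‖ ^ 2) + Real.negMulLog (‖β‖ ^ 2))) := by linarith
  have h6 := div_le_div_of_nonneg_right h5 hl.le
  refine le_trans (le_of_eq ?_) (h6.trans (le_of_eq ?_)) <;> ring

end EoS
end
end

section
/- Let α, β ∈ ℂ with |α|² + |β|² = 1 and αβ ≠ 0, let a, b ≥ 0 be nonnegative reals, and for 0 < t < 1 define f(t) = [(t|β|² + (1−t)|α|²) / (t(1−t))] · [ t·a + (1−t)·b + h₂(t) ]. Then f(t) ≥ |α|²·a + |β|²·b + h₂(|α|²) for all t ∈ (0,1). (In the paper a = E(Ψ) and b = E(Φ) are entanglement entropies, which are nonnegative reals.) -/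
open scoped BigOperators

noncomputable section

namespace EoS

variable {dA dB : ℕ}

/-- Gibbs' inequality for two-point distributions, in base 2. -/
theorem gibbs_two (p t : ℝ) (hp : 0 < p) (hp1 : p < 1) (ht : 0 < t) (ht1 : t < 1) :
    h2 p ≤ p * (-Real.logb 2 t) + (1 - p) * (-Real.logb 2 (1 - t)) := by
  have hq : 0 < 1 - p := by linarith
  have hs : 0 < 1 - t := by linarith
  have h2pos : 0 < Real.log 2 := Real.log_pos (by norm_num)
  have key : ∀ x y : ℝ, 0 < x → 0 < y → x * (Real.log y - Real.log x) ≤ y - x := by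
    intro x y hx hy
    have h := Real.log_le_sub_one_of_pos (div_pos hy hx)
    rw [Real.log_div hy.ne' hx.ne'] at h
    have h' := mul_le_mul_of_nonneg_left h hx.le
    have e : x * (y / x - 1) = y - x := by field_simp
    linarith
  have h1 := key p t hp ht
  have h3 := key (1 - p) (1 - t) hq hs
  have h4 : p * (Real.log t - Real.log p)
      + (1 - p) * (Real.log (1 - t) - Real.log (1 - p)) ≤ 0 := by linarith
  have h5 := div_nonpos_of_nonpos_of_nonneg h4 h2pos.le
  unfold h2 Real.logb
  have e : (p * (Real.log t - Real.log p)
      + (1 - p) * (Real.log (1 - t) - Real.log (1 - p))) / Real.log 2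
      = (-p * (Real.log p / Real.log 2) - (1 - p) * (Real.log (1 - p) / Real.log 2))
        - (p * (-(Real.log t / Real.log 2))
          + (1 - p) * (-(Real.log (1 - t) / Real.log 2))) := by ring
  linarith

/-- Comment (ii) after Theorem 3 of the paper:
`f(t) ≥ |α|²a + |β|²b + h₂(|α|²)` for all `t ∈ (0,1)`. -/
theorem f_ge_lps_mixture (α β : ℂ) (hαβ : ‖α‖ ^ 2 + ‖β‖ ^ 2 = 1) (hab0 : α * β ≠ 0)
    (a b : ℝ) (ha : 0 ≤ a) (hb : 0 ≤ b) :
    ∀ t : ℝ, 0 < t → t < 1 →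
      (t * ‖β‖ ^ 2 + (1 - t) * ‖α‖ ^ 2) / (t * (1 - t)) * (t * a + (1 - t) * b + h2 t)
        ≥ ‖α‖ ^ 2 * a + ‖β‖ ^ 2 * b + h2 (‖α‖ ^ 2) := by
  intro t ht ht1
  have hα : 0 < ‖α‖ ^ 2 := by
    have := norm_pos_iff.mpr (left_ne_zero_of_mul hab0)
    positivity
  have hβ : 0 < ‖β‖ ^ 2 := by
    have := norm_pos_iff.mpr (right_ne_zero_of_mul hab0)
    positivity
  have hq : ‖β‖ ^ 2 = 1 - ‖α‖ ^ 2 := by linarith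
  rw [hq] at hβ ⊢
  generalize ‖α‖ ^ 2 = p at *
  have hs : 0 < 1 - t := by linarith
  have g := gibbs_two p t hα (by linarith) ht ht1
  have hx : 0 ≤ -Real.logb 2 t := by
    have := Real.logb_nonpos (b := 2) (by norm_num) ht.le ht1.le
    linarith
  have hy : 0 ≤ -Real.logb 2 (1 - t) := by
    have := Real.logb_nonpos (b := 2) (by norm_num) hs.le (by linarith)
    linarith
  have e : (t * (1 - p) + (1 - t) * p) / (t * (1 - t)) * (t * a + (1 - t) * b + h2 t)
      = (p + (1 - p) * t / (1 - t)) * (a + -Real.logb 2 t)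
        + ((1 - p) + p * (1 - t) / t) * (b + -Real.logb 2 (1 - t)) := by
    unfold h2
    have := hs.ne'
    field_simp
    ring
  rw [e]
  have k1 : 0 ≤ (1 - p) * t / (1 - t) * (a + -Real.logb 2 t) := by positivity
  have k2 : 0 ≤ p * (1 - t) / t * (b + -Real.logb 2 (1 - t)) := by positivity
  nlinarith

end EoS
end
end

section
/- In H = ℂ³ ⊗ ℂ⁴, let Ψ = √(1/2)·e₀⊗f₀ + (1/2)·e₁⊗f₁ + (1/2)·e₂⊗f₂ and Φ = √(1/2)·e₀⊗f₃ + (1/2)·e₁⊗f₁ + (1/2)·e₂⊗f₂, where (e_i) and (f_j) are the standard orthonormal bases of ℂ³ and ℂ⁴, and let α = β = 1/√2. Then: (i) E(Ψ) = E(Φ) = 3/2; (ii) ‖αΨ + βΦ‖² = 3/2 and E(αΨ + βΦ) = log₂ 3; (iii) with ρ^A = |α|² Tr_B|Ψ⟩⟨Ψ| + |β|² Tr_B|Φ⟩⟨Φ| and ρ^B = |α|² Tr_A|Ψ⟩⟨Ψ| + |β|² Tr_A|Φ⟩⟨Φ|, one has S(ρ^A) = 3/2 and S(ρ^B) = 2.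 -/
open scoped BigOperators

noncomputable section

namespace EoS

variable {dA dB : ℕ}

lemma vnEntropy_diag {n : Type*} [Fintype n] [DecidableEq n] (ρ : Matrix n n ℂ) (d : n → ℝ)
    (h : ρ = Matrix.diagonal fun i => ((d i : ℝ) : ℂ)) :
    vnEntropy ρ = -∑ i, d i * Real.logb 2 (d i) := by
  have hH : ρ.IsHermitian := by
    rw [h]
    apply Matrix.isHermitian_diagonal_of_self_adjoint
    ext i
    simp
  unfold vnEntropy
  rw [dif_pos hH]
  have h1 := hH.roots_charpoly_eq_eigenvalues
  have h2 : ρ.charpoly.roots = Multiset.map (fun i => ((d i : ℝ) : ℂ)) Finset.univ.val := by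
    rw [h, Matrix.charpoly_diagonal]
    rw [Polynomial.roots_prod _ _ (Finset.prod_ne_zero_iff.mpr fun i _ => Polynomial.X_sub_C_ne_zero _)]
    simp
  rw [h2] at h1
  have h3 := congrArg (Multiset.map Complex.re) h1
  rw [Multiset.map_map, Multiset.map_map] at h3
  have h4 := congrArg (fun s => (Multiset.map (fun x : ℝ => x * Real.logb 2 x) s).sum) h3
  simp only [Multiset.map_map] at h4
  congr 1
  exact h4.symm

set_option maxHeartbeats 4000000 in
/-- Example 2 of the paper. -/
theorem example_3x4
    (Ψ Φ : TensorSpace 3 4)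
    (hΨ : Ψ = ((Real.sqrt (1 / 2) : ℝ) : ℂ) •
          tensor (EuclideanSpace.single 0 (1 : ℂ)) (EuclideanSpace.single 0 (1 : ℂ))
        + (1 / 2 : ℂ) •
          tensor (EuclideanSpace.single 1 (1 : ℂ)) (EuclideanSpace.single 1 (1 : ℂ))
        + (1 / 2 : ℂ) •
          tensor (EuclideanSpace.single 2 (1 : ℂ)) (EuclideanSpace.single 2 (1 : ℂ)))
    (hΦ : Φ = ((Real.sqrt (1 / 2) : ℝ) : ℂ) •
          tensor (EuclideanSpace.single 0 (1 : ℂ)) (EuclideanSpace.single 3 (1 : ℂ))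
        + (1 / 2 : ℂ) •
          tensor (EuclideanSpace.single 1 (1 : ℂ)) (EuclideanSpace.single 1 (1 : ℂ))
        + (1 / 2 : ℂ) •
          tensor (EuclideanSpace.single 2 (1 : ℂ)) (EuclideanSpace.single 2 (1 : ℂ)))
    (α β : ℂ) (hα : α = ((Real.sqrt 2)⁻¹ : ℂ)) (hβ : β = ((Real.sqrt 2)⁻¹ : ℂ)) :
    ent Ψ = 3 / 2 ∧ ent Φ = 3 / 2 ∧
    ‖α • Ψ + β • Φ‖ ^ 2 = 3 / 2 ∧
    entN (α • Ψ + β • Φ) = Real.logb 2 3 ∧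
    vnEntropy ((‖α‖ ^ 2 : ℝ) • trB (ketbra Ψ) + (‖β‖ ^ 2 : ℝ) • trB (ketbra Φ)) = 3 / 2 ∧
    vnEntropy ((‖α‖ ^ 2 : ℝ) • trA (ketbra Ψ) + (‖β‖ ^ 2 : ℝ) • trA (ketbra Φ)) = 2 := by
  have hs : Real.sqrt (1/2) = (Real.sqrt 2)⁻¹ := by
    rw [one_div, Real.sqrt_inv]
  have hr : ((Real.sqrt 2)⁻¹ : ℝ) * (Real.sqrt 2)⁻¹ = 1 / 2 := by
    rw [← mul_inv, Real.mul_self_sqrt (by norm_num)]; norm_num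
  rw [hs] at hΨ hΦ
  rw [← Complex.ofReal_inv] at hα hβ
  generalize (Real.sqrt 2)⁻¹ = r at *
  have hrc : (r : ℂ) * r = 1 / 2 := by
    rw [← Complex.ofReal_mul, hr]; norm_num
  have hc2 : (starRingEnd ℂ) 2 = 2 := Complex.conj_ofNat 2
  have hl2 : Real.logb 2 (1/2) = -1 := by
    rw [one_div, Real.logb_inv, Real.logb_self_eq_one (by norm_num)]
  have hl4 : Real.logb 2 (1/4) = -2 := by
    rw [show (1/4 : ℝ) = (1/2) * (1/2) by norm_num, Real.logb_mul (by norm_num) (by norm_num), hl2]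
    norm_num
  have hl3 : Real.logb 2 (1/3) = -Real.logb 2 3 := by
    rw [one_div, Real.logb_inv]
  have hnα : ‖α‖ ^ 2 = 1 / 2 := by
    rw [hα, Complex.norm_real, Real.norm_eq_abs, sq_abs, sq, hr]
  have hnβ : ‖β‖ ^ 2 = 1 / 2 := by
    rw [hβ, Complex.norm_real, Real.norm_eq_abs, sq_abs, sq, hr]
  have hBΨ : trB (ketbra Ψ) = Matrix.diagonal fun i => (((![1/2, 1/4, 1/4] : Fin 3 → ℝ) i : ℝ) : ℂ) := by
    subst hΨ
    ext i j
    fin_cases i <;> fin_cases j <;>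
      simp [trB, ketbra, tensor, Fin.sum_univ_succ, Matrix.diagonal, hrc, hc2] <;> norm_num
  have hBΦ : trB (ketbra Φ) = Matrix.diagonal fun i => (((![1/2, 1/4, 1/4] : Fin 3 → ℝ) i : ℝ) : ℂ) := by
    subst hΦ
    ext i j
    fin_cases i <;> fin_cases j <;>
      simp [trB, ketbra, tensor, Fin.sum_univ_succ, Matrix.diagonal, hrc, hc2] <;> norm_num
  have hAΨ : trA (ketbra Ψ) = Matrix.diagonal fun i => (((![1/2, 1/4, 1/4, 0] : Fin 4 → ℝ) i : ℝ) : ℂ) := by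
    subst hΨ
    ext i j
    fin_cases i <;> fin_cases j <;>
      simp [trA, ketbra, tensor, Fin.sum_univ_succ, Matrix.diagonal, hrc, hc2] <;> norm_num
  have hAΦ : trA (ketbra Φ) = Matrix.diagonal fun i => (((![0, 1/4, 1/4, 1/2] : Fin 4 → ℝ) i : ℝ) : ℂ) := by
    subst hΦ
    ext i j
    fin_cases i <;> fin_cases j <;>
      simp [trA, ketbra, tensor, Fin.sum_univ_succ, Matrix.diagonal, hrc, hc2] <;> norm_num
  have hX : ∀ p, (α • Ψ + β • Φ) p =
      (((fun q => ![![1/2, 0, 0, 1/2], ![0, r, 0, 0], ![0, 0, r, 0]] q.1 q.2 :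
        Fin 3 × Fin 4 → ℝ) p : ℝ) : ℂ) := by
    subst hΨ hΦ hα hβ
    rintro ⟨i, j⟩
    fin_cases i <;> fin_cases j <;> simp [tensor, hrc] <;> ring
  have hN : ‖α • Ψ + β • Φ‖ ^ 2 = 3 / 2 := by
    rw [EuclideanSpace.norm_sq_eq]
    simp only [hX, Complex.norm_real, Real.norm_eq_abs, sq_abs, Fintype.sum_prod_type]
    simp [Fin.sum_univ_succ]
    nlinarith
  have h34 : ∀ M : Matrix (Fin 3) (Fin 3) ℂ,
      M = (Matrix.diagonal fun i => (((![1/2, 1/4, 1/4] : Fin 3 → ℝ) i : ℝ) : ℂ)) →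
      vnEntropy M = 3 / 2 := by
    intro M hM
    rw [vnEntropy_diag M _ hM]
    simp only [Fin.sum_univ_succ, Matrix.cons_val_zero, Matrix.cons_val_succ, Fin.sum_univ_zero,
      hl2, hl4]
    norm_num
  refine ⟨h34 _ hBΨ, h34 _ hBΦ, hN, ?_, ?_, ?_⟩
  · have hc : ((‖α • Ψ + β • Φ‖⁻¹ : ℝ) : ℂ) * ((‖α • Ψ + β • Φ‖⁻¹ : ℝ) : ℂ) = 2 / 3 := by
      rw [← Complex.ofReal_mul, ← mul_inv, ← sq, hN]
      norm_num
    unfold entN ent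
    generalize ‖α • Ψ + β • Φ‖⁻¹ = c at *
    generalize α • Ψ + β • Φ = X at *
    rw [vnEntropy_diag _ (fun _ => 1 / 3) ?_]
    · simp only [hl3]
      simp
    · ext i j
      have hk : ∀ p q, ketbra (c • X) p q = (2 / 3) * (X p * (starRingEnd ℂ) (X q)) := by
        intro p q
        rw [← hc]
        simp [ketbra]
        ring
      simp only [trB, hk, hX, Complex.conj_ofReal]
      fin_cases i <;> fin_cases j <;>
        simp [Fin.sum_univ_succ, Matrix.diagonal, hrc, hc2] <;> norm_num
  · apply h34
    rw [hnα, hnβ, hBΨ, hBΦ, ← add_smul]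
    norm_num
  · rw [vnEntropy_diag _ (fun _ => 1 / 4) ?_]
    · simp only [hl4]
      norm_num
    · rw [hnα, hnβ, hAΨ, hAΦ]
      ext i j
      fin_cases i <;> fin_cases j <;> simp [Matrix.diagonal] <;> norm_num

end EoS
end
end

section
/- Let d ≥ 2 and work in H = ℂ^d ⊗ ℂ^d with standard orthonormal basis (e_k) of ℂ^d indexed by k = 1,…,d. Let Ψ = (1/√2)( e₁⊗e₁ + (1/√(d−1)) ∑_{k=2}^{d} e_k⊗e_k ) and Φ = (1/√2)( e₁⊗e₁ − (1/√(d−1)) ∑_{k=2}^{d} e_k⊗e_k ). Then: (i) Ψ and Φ are orthogonal unit vectors with E(Ψ) = E(Φ) = (1/2)log₂(d−1) + 1; (ii) for α = 3/5 and β = −4/5, the vector αΨ + βΦ is a unit vector and E(αΨ + βΦ) = (49/50)·log₂(d−1) + h₂(1/50). -/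
open scoped BigOperators

noncomputable section

namespace EoS

variable {dA dB : ℕ}

/-- Sum of a function of a vector with one special entry. -/
lemma sum_special (d : ℕ) (z : Fin d) (f : ℝ → ℝ) (a b : ℝ) :
    ∑ i : Fin d, f (if i = z then a else b) = f a + ((d : ℝ) - 1) * f b := by
  have hd : 1 ≤ d := by have := z.2; omega
  rw [← Finset.add_sum_erase _ _ (Finset.mem_univ z)]
  have : ∑ i ∈ Finset.univ.erase z, f (if i = z then a else b)
      = ∑ i ∈ Finset.univ.erase z, f b := by
    apply Finset.sum_congr rfl
    intro i hi
    rw [if_neg (Finset.ne_of_mem_erase hi)]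
  rw [this]
  simp [Finset.card_erase_of_mem, Nat.cast_sub hd]

lemma vnEntropy_diagonal {n : Type*} [Fintype n] [DecidableEq n] (l : n → ℝ) :
    vnEntropy (Matrix.diagonal fun i => (l i : ℂ)) = -∑ i, l i * Real.logb 2 (l i) := by
  have h : (Matrix.diagonal fun i => (l i : ℂ)).IsHermitian := by
    apply Matrix.isHermitian_diagonal_of_self_adjoint
    ext i
    simp
  unfold vnEntropy
  rw [dif_pos h]
  have h1 := h.roots_charpoly_eq_eigenvalues
  rw [Matrix.charpoly_diagonal, Polynomial.roots_prod _ _ (by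
    simp [Finset.prod_ne_zero_iff, Polynomial.X_sub_C_ne_zero])] at h1
  simp only [Polynomial.roots_X_sub_C, Multiset.bind_singleton] at h1
  have h2 := congrArg (fun s : Multiset ℂ =>
    (s.map (fun z : ℂ => z.re * Real.logb 2 z.re)).sum) h1
  simp only [Multiset.map_map, Function.comp_def] at h2
  rw [neg_inj]
  simpa using h2.symm

lemma key (d : ℕ) (hd : 2 ≤ d) (z : Fin d) (ψ : TensorSpace d d) (a b x : ℝ)
    (hψ : ∀ p, ψ p = if p.1 = p.2 then
      (((if p.1 = z then a else b / Real.sqrt ((d : ℝ) - 1) : ℝ)) : ℂ) else 0)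
    (ha : a ^ 2 = x) (hb : b ^ 2 = 1 - x) (hx1 : x < 1) :
    ‖ψ‖ = 1 ∧ ent ψ = (1 - x) * Real.logb 2 ((d : ℝ) - 1) + h2 x := by
  have hd' : (2 : ℝ) ≤ d := by exact_mod_cast hd
  have hD : (0 : ℝ) < (d : ℝ) - 1 := by linarith
  have hb' : (b / Real.sqrt ((d : ℝ) - 1)) ^ 2 = (1 - x) / ((d : ℝ) - 1) := by
    rw [div_pow, Real.sq_sqrt hD.le, hb]
  set c : Fin d → ℝ := fun i => if i = z then a else b / Real.sqrt ((d : ℝ) - 1) with hc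
  have hψ' : ∀ i j, ψ (i, j) = if i = j then (c i : ℂ) else 0 := fun i j => hψ (i, j)
  constructor
  · have : ‖ψ‖ ^ 2 = 1 := by
      rw [EuclideanSpace.norm_sq_eq, Fintype.sum_prod_type]
      have : ∀ i, ∑ j, ‖ψ (i, j)‖ ^ 2 = c i ^ 2 := by
        intro i
        rw [Finset.sum_eq_single i]
        · simp [hψ']
        · intro j _ hj
          simp [hψ', hj.symm]
        · simp
      simp only [this]
      rw [sum_special d z (fun y => y ^ 2), hb', ha]
      field_simp
      ring
    nlinarith [norm_nonneg ψ]
  · have : trB (ketbra ψ) = Matrix.diagonal fun i => ((c i ^ 2 : ℝ) : ℂ) := by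
      ext i j
      simp only [trB, ketbra, hψ', Matrix.diagonal_apply]
      by_cases hij : i = j
      · subst hij
        simp [sq]
      · rw [if_neg hij]
        apply Finset.sum_eq_zero
        intro k _
        by_cases hik : i = k
        · subst hik
          simp [Ne.symm hij]
        · simp [hik]
    rw [ent, this, vnEntropy_diagonal,
      sum_special d z (fun y => y ^ 2 * Real.logb 2 (y ^ 2)), hb', ha,
      Real.logb_div (by linarith) hD.ne', h2]
    field_simp
    ring

/-- (Example 3 of the paper), in `ℂ^d ⊗ ℂ^d`; the basis vector `e₁` of
the paper is `EuclideanSpace.single ⟨0, _⟩ 1` and `∑_{k=2}^d` is the sum over the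
remaining indices. -/
theorem example_d_dim (d : ℕ) (hd : 2 ≤ d)
    (Ψ Φ : TensorSpace d d)
    (hΨ : Ψ = ((Real.sqrt 2)⁻¹ : ℂ) •
        (tensor (EuclideanSpace.single (⟨0, by omega⟩ : Fin d) (1 : ℂ))
            (EuclideanSpace.single (⟨0, by omega⟩ : Fin d) (1 : ℂ))
          + ((Real.sqrt ((d : ℝ) - 1))⁻¹ : ℂ) •
            ∑ k ∈ Finset.univ.erase (⟨0, by omega⟩ : Fin d),
              tensor (EuclideanSpace.single k (1 : ℂ)) (EuclideanSpace.single k (1 : ℂ))))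
    (hΦ : Φ = ((Real.sqrt 2)⁻¹ : ℂ) •
        (tensor (EuclideanSpace.single (⟨0, by omega⟩ : Fin d) (1 : ℂ))
            (EuclideanSpace.single (⟨0, by omega⟩ : Fin d) (1 : ℂ))
          - ((Real.sqrt ((d : ℝ) - 1))⁻¹ : ℂ) •
            ∑ k ∈ Finset.univ.erase (⟨0, by omega⟩ : Fin d),
              tensor (EuclideanSpace.single k (1 : ℂ)) (EuclideanSpace.single k (1 : ℂ)))) :
    (inner ℂ Ψ Φ : ℂ) = 0 ∧ ‖Ψ‖ = 1 ∧ ‖Φ‖ = 1 ∧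
    ent Ψ = (1 / 2) * Real.logb 2 ((d : ℝ) - 1) + 1 ∧
    ent Φ = (1 / 2) * Real.logb 2 ((d : ℝ) - 1) + 1 ∧
    ‖(3 / 5 : ℂ) • Ψ + (-(4 / 5) : ℂ) • Φ‖ = 1 ∧
    ent ((3 / 5 : ℂ) • Ψ + (-(4 / 5) : ℂ) • Φ)
      = (49 / 50) * Real.logb 2 ((d : ℝ) - 1) + h2 (1 / 50) := by
  have hd' : (2 : ℝ) ≤ d := by exact_mod_cast hd
  have hD : (0 : ℝ) < (d : ℝ) - 1 := by linarith
  have hs2 : (Real.sqrt 2) ^ 2 = 2 := Real.sq_sqrt (by norm_num)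
  set z : Fin d := ⟨0, by omega⟩ with hz
  have ht : ∀ (k : Fin d) (p : Fin d × Fin d),
      (tensor (EuclideanSpace.single k (1 : ℂ)) (EuclideanSpace.single k (1 : ℂ))) p
        = if p.1 = p.2 then (if p.1 = k then 1 else 0) else 0 := by
    rintro k ⟨i, j⟩
    simp only [tensor, PiLp.single_apply]
    split_ifs <;> simp_all
  have hS : ∀ p : Fin d × Fin d, (∑ k ∈ Finset.univ.erase z,
      tensor (EuclideanSpace.single k (1 : ℂ)) (EuclideanSpace.single k (1 : ℂ))) p
        = if p.1 = p.2 then (if p.1 = z then 0 else 1) else 0 := by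
    rintro ⟨i, j⟩
    simp only [WithLp.ofLp_sum, Finset.sum_apply, ht]
    by_cases hij : i = j
    · subst hij
      by_cases hi : i = z
      · simp [hi]
      · simp [hi]
    · simp [hij]
  have hΨp : ∀ p, Ψ p = if p.1 = p.2 then
      (((if p.1 = z then (Real.sqrt 2)⁻¹ else
        (Real.sqrt 2)⁻¹ / Real.sqrt ((d : ℝ) - 1) : ℝ)) : ℂ) else 0 := by
    intro p
    simp only [hΨ, PiLp.smul_apply, PiLp.add_apply, hS, ht, smul_eq_mul]
    split_ifs <;> simp [div_eq_mul_inv]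
  have hΦp : ∀ p, Φ p = if p.1 = p.2 then
      (((if p.1 = z then (Real.sqrt 2)⁻¹ else
        (-(Real.sqrt 2)⁻¹) / Real.sqrt ((d : ℝ) - 1) : ℝ)) : ℂ) else 0 := by
    intro p
    simp only [hΦ, PiLp.smul_apply, PiLp.sub_apply, hS, ht, smul_eq_mul]
    split_ifs <;> simp [div_eq_mul_inv]
  have hCp : ∀ p, ((3 / 5 : ℂ) • Ψ + (-(4 / 5) : ℂ) • Φ) p = if p.1 = p.2 then
      (((if p.1 = z then -(1 / 5) * (Real.sqrt 2)⁻¹ else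
        (7 / 5 * (Real.sqrt 2)⁻¹) / Real.sqrt ((d : ℝ) - 1) : ℝ)) : ℂ) else 0 := by
    intro p
    simp only [PiLp.smul_apply, PiLp.add_apply, hΨp, hΦp, smul_eq_mul]
    split_ifs <;> push_cast <;> ring
  have k1 := key d hd z Ψ _ _ (1 / 2) hΨp (by rw [inv_pow, hs2]; norm_num)
    (by rw [inv_pow, hs2]; norm_num) (by norm_num)
  have k2 := key d hd z Φ _ _ (1 / 2) hΦp (by rw [inv_pow, hs2]; norm_num)
    (by rw [neg_sq, inv_pow, hs2]; norm_num) (by norm_num)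
  have k3 := key d hd z _ _ _ (1 / 50) hCp (by rw [mul_pow, inv_pow, hs2]; norm_num)
    (by rw [mul_pow, inv_pow, hs2]; norm_num) (by norm_num)
  have hh : h2 (1 / 2) = 1 := by
    have : Real.logb 2 (1 / 2) = -1 := by
      rw [one_div, Real.logb_inv, Real.logb_self_eq_one (by norm_num)]
    unfold h2
    rw [show (1 : ℝ) - 1 / 2 = 1 / 2 by norm_num, this]
    norm_num
  refine ⟨?_, k1.1, k2.1, ?_, ?_, k3.1, ?_⟩
  · have key0 : ∀ i, ∑ j, inner ℂ (Ψ (i, j)) (Φ (i, j))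
        = (((fun y : ℝ => y) (if i = z then (1 / 2 : ℝ) else -(1 / 2) / ((d : ℝ) - 1)) : ℝ) : ℂ) := by
      intro i
      rw [Finset.sum_eq_single i]
      · rw [hΨp, hΦp]
        simp only [if_true]
        by_cases hi : i = z
        · simp only [hi, if_true]
          rw [RCLike.inner_apply, Complex.conj_ofReal, ← Complex.ofReal_mul, ← sq, inv_pow, hs2]
          norm_num
        · simp only [hi, if_false]
          rw [RCLike.inner_apply, Complex.conj_ofReal, ← Complex.ofReal_mul, div_mul_div_comm,
            Real.mul_self_sqrt hD.le, neg_mul, ← sq, inv_pow, hs2]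
          norm_num
      · intro j _ hj
        simp [hΨp, hj.symm]
      · simp
    rw [PiLp.inner_apply, Fintype.sum_prod_type]
    simp only [key0]
    rw [← Complex.ofReal_sum, sum_special d z (fun y => y)]
    rw [mul_div_cancel₀ _ hD.ne']
    norm_num
  · rw [k1.2, hh]; norm_num
  · rw [k2.2, hh]; norm_num
  · rw [k3.2]; norm_num

end EoS
end
end
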